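/- Let d₁, d₂ ≥ 1 and let C : Matrix (Fin d₁ × Fin d₂) (Fin d₁ × Fin d₂) ℂ be any matrix, and set d = max{d₁, d₂}. Then ‖tr₁ C‖₂² + ‖tr₂ C‖₂² ≤ d·‖C‖₂² + (1/d)·|tr C|². -/

import Mathlib

open Finset

/-- Squared Frobenius (Hilbert–Schmidt) norm of a complex matrix. -/
noncomputable def frobSq {m n : Type*} [Fintype m] [Fintype n] (M : Matrix m n ℂ) : ℝ :=
  ∑ p, ∑ q, ‖M p q‖ ^ 2

/-- Partial trace over the first tensor factor. -/
noncomputable def ptr1 {d₁ d₂ : ℕ} (C : Matrix (Fin d₁ × Fin d₂) (Fin d₁ × Fin d₂) ℂ) :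
    Matrix (Fin d₂) (Fin d₂) ℂ :=
  Matrix.of fun j j' => ∑ i, C (i, j) (i, j')

/-- Partial trace over the second tensor factor. -/
noncomputable def ptr2 {d₁ d₂ : ℕ} (C : Matrix (Fin d₁ × Fin d₂) (Fin d₁ × Fin d₂) ℂ) :
    Matrix (Fin d₁) (Fin d₁) ℂ :=
  Matrix.of fun i i' => ∑ j, C (i, j) (i', j)

/-- Removing the scalar part of a square matrix lowers its squared Frobenius norm by
`|tr M|² / n`. -/
theorem frobSq_sub_scalar {n : ℕ} (hn : 1 ≤ n) (M : Matrix (Fin n) (Fin n) ℂ) :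
    frobSq (M - (M.trace / n) • (1 : Matrix (Fin n) (Fin n) ℂ))
      = frobSq M - ‖M.trace‖ ^ 2 / n := by
  have hn' : (n : ℝ) ≠ 0 := by positivity
  set c : ℂ := M.trace / n with hc
  have hT : M.trace = n * c := by
    rw [hc, mul_div_cancel₀ _ (by exact_mod_cast hn')]
  have key : ∀ p q, ‖(M - c • (1 : Matrix (Fin n) (Fin n) ℂ)) p q‖ ^ 2
      = ‖M p q‖ ^ 2 + if p = q then ‖c‖ ^ 2 - 2 * (M p p * star c).re else 0 := by
    intro p q
    by_cases h : p = q
    · subst h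
      simp [← Complex.normSq_eq_norm_sq, Complex.normSq_sub]
      ring
    · simp [h]
  have hre : ∑ p, (M p p * star c).re = n * ‖c‖ ^ 2 := by
    rw [← Complex.re_sum, ← Finset.sum_mul]
    change (M.trace * star c).re = _
    rw [hT, mul_assoc, ← Complex.normSq_eq_norm_sq]
    simp [Complex.normSq_apply]
  simp only [frobSq, key, sum_add_distrib, sum_ite_eq, mem_univ, if_true, sum_sub_distrib,
    ← mul_sum, hre]
  rw [hT]
  simp
  field_simp
  ring

theorem frobSq_nonneg {m n : Type*} [Fintype m] [Fintype n] (M : Matrix m n ℂ) :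
    0 ≤ frobSq M := by
  unfold frobSq; positivity

theorem norm_trace_sq_le {n : ℕ} (hn : 1 ≤ n) (M : Matrix (Fin n) (Fin n) ℂ) :
    ‖M.trace‖ ^ 2 ≤ n * frobSq M := by
  have h := frobSq_nonneg (M - (M.trace / n) • (1 : Matrix (Fin n) (Fin n) ℂ))
  rw [frobSq_sub_scalar hn, sub_nonneg, div_le_iff₀ (by positivity)] at h
  linarith

theorem frobSq_eq_sum_frobSq_blocks {d₁ d₂ : ℕ}
    (C : Matrix (Fin d₁ × Fin d₂) (Fin d₁ × Fin d₂) ℂ) :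
    frobSq C = ∑ j, ∑ j', frobSq (Matrix.of fun i i' => C (i, j) (i', j')) := by
  simp only [frobSq, Fintype.sum_prod_type, Matrix.of_apply]
  rw [sum_comm]
  refine sum_congr rfl fun j _ => ?_
  conv_rhs => rw [sum_comm]
  exact sum_congr rfl fun i _ => sum_comm

theorem frobSq_submatrix_swap {d₁ d₂ : ℕ}
    (C : Matrix (Fin d₁ × Fin d₂) (Fin d₁ × Fin d₂) ℂ) :
    frobSq (C.submatrix Prod.swap Prod.swap) = frobSq C := by
  unfold frobSq
  refine Fintype.sum_equiv (Equiv.prodComm _ _) _ _ fun p => ?_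
  exact Fintype.sum_equiv (Equiv.prodComm _ _) _ _ fun q => rfl

theorem trace_submatrix_swap {d₁ d₂ : ℕ}
    (C : Matrix (Fin d₁ × Fin d₂) (Fin d₁ × Fin d₂) ℂ) :
    (C.submatrix Prod.swap Prod.swap).trace = C.trace :=
  Fintype.sum_equiv (Equiv.prodComm _ _) _ _ fun _ => rfl

theorem frobSq_ptr1_le {d₁ d₂ : ℕ} (hd₁ : 1 ≤ d₁)
    (C : Matrix (Fin d₁ × Fin d₂) (Fin d₁ × Fin d₂) ℂ) :
    frobSq (ptr1 C) ≤ d₁ * frobSq C := by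
  rw [frobSq_eq_sum_frobSq_blocks, mul_sum]
  refine sum_le_sum fun j _ => ?_
  rw [mul_sum]
  exact sum_le_sum fun j' _ =>
    norm_trace_sq_le hd₁ (Matrix.of fun i i' => C (i, j) (i', j'))

theorem frobSq_ptr2_le {d₁ d₂ : ℕ} (hd₂ : 1 ≤ d₂)
    (C : Matrix (Fin d₁ × Fin d₂) (Fin d₁ × Fin d₂) ℂ) :
    frobSq (ptr2 C) ≤ d₂ * frobSq C := by
  rw [← frobSq_submatrix_swap C]
  exact frobSq_ptr1_le hd₂ (C.submatrix Prod.swap Prod.swap)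

theorem trace_ptr2 {d₁ d₂ : ℕ} (C : Matrix (Fin d₁ × Fin d₂) (Fin d₁ × Fin d₂) ℂ) :
    (ptr2 C).trace = C.trace := by
  simp [ptr2, Matrix.trace, Fintype.sum_prod_type]

/-- The inequality when the first tensor factor has the larger dimension. -/
theorem sum_partial_traces_le_of_le {d₁ d₂ : ℕ} (hd₂ : 1 ≤ d₂) (h : d₂ ≤ d₁)
    (C : Matrix (Fin d₁ × Fin d₂) (Fin d₁ × Fin d₂) ℂ) :
    frobSq (ptr1 C) + frobSq (ptr2 C)
      ≤ (d₁ : ℝ) * frobSq C + (1 / (d₁ : ℝ)) * ‖C.trace‖ ^ 2 := by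
  have hd₁ : 1 ≤ d₁ := hd₂.trans h
  have hpos : (0 : ℝ) < d₁ := by positivity
  set D : Matrix (Fin d₁ × Fin d₂) (Fin d₁ × Fin d₂) ℂ :=
    Matrix.of fun p q => C p q - ptr1 C p.2 q.2 / d₁ * (1 : Matrix (Fin d₁) (Fin d₁) ℂ) p.1 q.1
  have hDnorm : frobSq D = frobSq C - frobSq (ptr1 C) / d₁ := by
    rw [frobSq_eq_sum_frobSq_blocks D, frobSq_eq_sum_frobSq_blocks C]
    conv_rhs => rw [frobSq.eq_1 (ptr1 C)]
    simp only [sum_div, ← sum_sub_distrib]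
    refine sum_congr rfl fun j _ => sum_congr rfl fun j' _ => ?_
    exact frobSq_sub_scalar hd₁ (Matrix.of fun i i' => C (i, j) (i', j'))
  have hDtr : frobSq (ptr2 D) = frobSq (ptr2 C) - ‖C.trace‖ ^ 2 / d₁ := by
    rw [← trace_ptr2 C, ← frobSq_sub_scalar hd₁ (ptr2 C)]
    congr 1
    ext i i'
    have ht : ∑ j, ptr1 C j j = (ptr2 C).trace := by
      simp only [ptr1, ptr2, Matrix.trace, Matrix.diag_apply, Matrix.of_apply]
      exact sum_comm
    change ∑ j, (C (i, j) (i', j) - ptr1 C j j / d₁ * (1 : Matrix (Fin d₁) (Fin d₁) ℂ) i i')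
      = ∑ j, C (i, j) (i', j)
        - (ptr2 C).trace / d₁ * (1 : Matrix (Fin d₁) (Fin d₁) ℂ) i i'
    rw [sum_sub_distrib, ← sum_mul, ← sum_div, ht]
  have hle := frobSq_ptr2_le hd₂ D
  have hmono : (d₂ : ℝ) * frobSq D ≤ d₁ * frobSq D :=
    mul_le_mul_of_nonneg_right (by exact_mod_cast h) (frobSq_nonneg D)
  have hexp : (d₁ : ℝ) * frobSq D = d₁ * frobSq C - frobSq (ptr1 C) := by
    rw [hDnorm]; field_simp
  rw [one_div_mul_eq_div]
  linarith

/-- For any bipartite matrix `C`, with `d = max{d₁, d₂}`,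
`‖tr₁C‖₂² + ‖tr₂C‖₂² ≤ d‖C‖₂² + (1/d)|tr C|²`. -/
theorem sum_partial_traces_le_dim (d₁ d₂ : ℕ) (hd₁ : 1 ≤ d₁) (hd₂ : 1 ≤ d₂)
    (C : Matrix (Fin d₁ × Fin d₂) (Fin d₁ × Fin d₂) ℂ) :
    frobSq (ptr1 C) + frobSq (ptr2 C)
      ≤ (max d₁ d₂ : ℝ) * frobSq C + (1 / (max d₁ d₂ : ℝ)) * ‖C.trace‖ ^ 2 := by
  rcases le_total d₂ d₁ with h | h
  · rw [max_eq_left (by exact_mod_cast h : (d₂ : ℝ) ≤ d₁)]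
    exact sum_partial_traces_le_of_le hd₂ h C
  · rw [max_eq_right (by exact_mod_cast h : (d₁ : ℝ) ≤ d₂), add_comm (frobSq (ptr1 C)),
      ← frobSq_submatrix_swap C, ← trace_submatrix_swap C]
    exact sum_partial_traces_le_of_le hd₁ h (C.submatrix Prod.swap Prod.swap)
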